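/- arXiv:2501.01252 — 3 statements merged into one kernel-verified Lean document; each statement's English description precedes it below -/
import Mathlib

section
/- Let ι be a finite index set, let (A_k)_{k∈ι} be a family of skew-symmetric matrices in M_n(ℝ) and (B_k)_{k∈ι} a family of skew-symmetric matrices in M_m(ℝ). Then the matrix −∑_{k∈ι} A_k ⊗ₖ B_k − (1/2) ∑_{k∈ι} (A_k² ⊗ₖ I_m + I_n ⊗ₖ B_k²) is positive semidefinite. -/
open Matrix Kronecker BigOperators

/-- The negative of the square of the skew-symmetric matrix `A ⊗ₖ 1 + 1 ⊗ₖ B`. -/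
theorem Matrix.conjTranspose_mul_self_kronecker_add_of_skew {n m : Type*} [Fintype n] [Fintype m]
    [DecidableEq n] [DecidableEq m] {A : Matrix n n ℝ} {B : Matrix m m ℝ}
    (hA : Aᵀ = -A) (hB : Bᵀ = -B) :
    (A ⊗ₖ (1 : Matrix m m ℝ) + (1 : Matrix n n ℝ) ⊗ₖ B)ᴴ *
        (A ⊗ₖ (1 : Matrix m m ℝ) + (1 : Matrix n n ℝ) ⊗ₖ B) =
      -((2 : ℝ) • A ⊗ₖ B) -
        ((A * A) ⊗ₖ (1 : Matrix m m ℝ) + (1 : Matrix n n ℝ) ⊗ₖ (B * B)) := by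
  have h : (A ⊗ₖ (1 : Matrix m m ℝ) + (1 : Matrix n n ℝ) ⊗ₖ B)ᴴ =
      -(A ⊗ₖ (1 : Matrix m m ℝ) + (1 : Matrix n n ℝ) ⊗ₖ B) := by
    rw [conjTranspose_eq_transpose_of_trivial, transpose_add, ← kroneckerMap_transpose,
      ← kroneckerMap_transpose, hA, hB, transpose_one, transpose_one, ← neg_one_smul ℝ A,
      ← neg_one_smul ℝ B, smul_kronecker, kronecker_smul, ← smul_add, neg_one_smul]
  rw [h, neg_mul, add_mul, mul_add, mul_add]
  simp only [← mul_kronecker_mul, mul_one, one_mul, two_smul]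
  abel

/-- **Goette–Semmelmann trick.** For finite families of skew-symmetric real
matrices `A k` and `B k`, the matrix
`−∑ A k ⊗ₖ B k − (1/2) ∑ (A k² ⊗ₖ I + I ⊗ₖ B k²)` is positive semidefinite. -/
theorem stmt_0 {ι : Type*} [Fintype ι] {n m : ℕ}
    (A : ι → Matrix (Fin n) (Fin n) ℝ) (B : ι → Matrix (Fin m) (Fin m) ℝ)
    (hA : ∀ k, (A k)ᵀ = -A k) (hB : ∀ k, (B k)ᵀ = -B k) :
    (-(∑ k, A k ⊗ₖ B k) -
      (1 / 2 : ℝ) • ∑ k, ((A k * A k) ⊗ₖ (1 : Matrix (Fin m) (Fin m) ℝ) +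
        (1 : Matrix (Fin n) (Fin n) ℝ) ⊗ₖ (B k * B k))).PosSemidef := by
  have h : -(∑ k, A k ⊗ₖ B k) -
      (1 / 2 : ℝ) • ∑ k, ((A k * A k) ⊗ₖ (1 : Matrix (Fin m) (Fin m) ℝ) +
        (1 : Matrix (Fin n) (Fin n) ℝ) ⊗ₖ (B k * B k)) =
      (1 / 2 : ℝ) • ∑ k,
        (A k ⊗ₖ (1 : Matrix (Fin m) (Fin m) ℝ) + (1 : Matrix (Fin n) (Fin n) ℝ) ⊗ₖ B k)ᴴ *
          (A k ⊗ₖ (1 : Matrix (Fin m) (Fin m) ℝ) + (1 : Matrix (Fin n) (Fin n) ℝ) ⊗ₖ B k) := by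
    simp only [conjTranspose_mul_self_kronecker_add_of_skew (hA _) (hB _),
      Finset.sum_sub_distrib, Finset.sum_neg_distrib, ← Finset.smul_sum]
    module
  rw [h]
  exact (posSemidef_sum _ fun k _ => posSemidef_conjTranspose_mul_self _).smul (by norm_num)
end

section
/- Let ι be a finite index set, let (A_k)_{k∈ι} be skew-symmetric matrices in M_n(ℝ), (B_k)_{k∈ι} skew-symmetric matrices in M_m(ℝ), and θ_k > 0 real numbers. Then the matrix −∑_{k∈ι} A_k ⊗ₖ B_k − (1/2) ∑_{k∈ι} (θ_k⁻² · A_k² ⊗ₖ I_m + θ_k² · I_n ⊗ₖ B_k²) is positive semidefinite. -/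
open Matrix Kronecker BigOperators

/-- The square of a skew-symmetric real matrix is negative semidefinite. -/
theorem posSemidef_neg_mul_self_of_transpose_eq_neg {p : Type*} [Fintype p]
    {C : Matrix p p ℝ} (hC : Cᵀ = -C) : (-(C * C)).PosSemidef := by
  have h := posSemidef_conjTranspose_mul_self C
  rwa [conjTranspose_eq_transpose_of_trivial, hC, neg_mul] at h

/-- The square of `t⁻¹ • A ⊗ₖ I + t • I ⊗ₖ B`. -/
theorem smul_kronecker_one_add_smul_one_kronecker_mul_self {p q : Type*} [Fintype p]
    [DecidableEq p] [Fintype q] [DecidableEq q] (A : Matrix p p ℝ) (B : Matrix q q ℝ)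
    {t : ℝ} (ht : t ≠ 0) :
    (t⁻¹ • (A ⊗ₖ (1 : Matrix q q ℝ)) + t • ((1 : Matrix p p ℝ) ⊗ₖ B)) *
        (t⁻¹ • (A ⊗ₖ (1 : Matrix q q ℝ)) + t • ((1 : Matrix p p ℝ) ⊗ₖ B)) =
      (2 : ℝ) • (A ⊗ₖ B) + (t⁻¹ ^ 2 • ((A * A) ⊗ₖ (1 : Matrix q q ℝ)) +
        t ^ 2 • ((1 : Matrix p p ℝ) ⊗ₖ (B * B))) := by
  simp only [add_mul, mul_add, smul_mul_assoc, mul_smul_comm,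
    ← mul_kronecker_mul, mul_one, one_mul]
  match_scalars <;> field_simp
  norm_num

/-- **Weighted Goette–Semmelmann trick.** For finite families of skew-symmetric real
matrices `A k`, `B k` and positive weights `θ k`, the matrix
`−∑ A k ⊗ₖ B k − (1/2) ∑ (θ k⁻² • A k² ⊗ₖ I + θ k² • I ⊗ₖ B k²)` is positive
semidefinite. -/
theorem stmt_1 {ι : Type*} [Fintype ι] {n m : ℕ}
    (A : ι → Matrix (Fin n) (Fin n) ℝ) (B : ι → Matrix (Fin m) (Fin m) ℝ)
    (θ : ι → ℝ) (hθ : ∀ k, 0 < θ k)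
    (hA : ∀ k, (A k)ᵀ = -A k) (hB : ∀ k, (B k)ᵀ = -B k) :
    (-(∑ k, A k ⊗ₖ B k) -
      (1 / 2 : ℝ) • ∑ k, ((θ k)⁻¹ ^ 2 • ((A k * A k) ⊗ₖ (1 : Matrix (Fin m) (Fin m) ℝ)) +
        (θ k) ^ 2 • ((1 : Matrix (Fin n) (Fin n) ℝ) ⊗ₖ (B k * B k)))).PosSemidef := by
  have hsum : -(∑ k, A k ⊗ₖ B k) -
      (1 / 2 : ℝ) • ∑ k, ((θ k)⁻¹ ^ 2 • ((A k * A k) ⊗ₖ (1 : Matrix (Fin m) (Fin m) ℝ)) +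
        (θ k) ^ 2 • ((1 : Matrix (Fin n) (Fin n) ℝ) ⊗ₖ (B k * B k))) =
      ∑ k, (1 / 2 : ℝ) •
        -(((θ k)⁻¹ • (A k ⊗ₖ (1 : Matrix (Fin m) (Fin m) ℝ)) +
            θ k • ((1 : Matrix (Fin n) (Fin n) ℝ) ⊗ₖ B k)) *
          ((θ k)⁻¹ • (A k ⊗ₖ (1 : Matrix (Fin m) (Fin m) ℝ)) +
            θ k • ((1 : Matrix (Fin n) (Fin n) ℝ) ⊗ₖ B k))) := by
    rw [Finset.smul_sum, ← Finset.sum_neg_distrib, ← Finset.sum_sub_distrib]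
    refine Finset.sum_congr rfl fun k _ => ?_
    rw [smul_kronecker_one_add_smul_one_kronecker_mul_self _ _ (hθ k).ne']
    module
  rw [hsum]
  refine posSemidef_sum _ fun k _ => PosSemidef.smul ?_ (by norm_num)
  apply posSemidef_neg_mul_self_of_transpose_eq_neg
  rw [transpose_add, transpose_smul, transpose_smul, ← kroneckerMap_transpose,
    ← kroneckerMap_transpose, hA, hB, transpose_one, transpose_one]
  ext i j
  simp only [Matrix.add_apply, Matrix.neg_apply, Matrix.smul_apply, kroneckerMap_apply, smul_eq_mul]
  ring
end

section
/- Let Q be the quadratic form on EuclideanSpace ℝ (Fin n) given by Q(x) = −‖x‖², let Cl(Q) be its Clifford algebra with canonical map ι, and set e_i = ι(b_i) for the standard orthonormal basis (b_i). Let c : Fin n → Fin n → Fin n → Fin n → ℝ be a curvature-type tensor and μ : Fin n → ℝ arbitrary weights. Then in Cl(Q): ∑_{i,j,k,l} μ_i μ_j μ_k μ_l · c i j k l · e_i e_j e_k e_l = algebraMap ℝ Cl(Q) ( −2 ∑_{i,j} μ_i² μ_j² · c i j i j ). -/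
open scoped BigOperators

/-- A map `c : Fin n → Fin n → Fin n → Fin n → ℝ` is a curvature-type tensor if it has
the pair symmetry, the two antisymmetries, and satisfies the first Bianchi identity. -/
def IsCurvatureTensor {n : ℕ} (c : Fin n → Fin n → Fin n → Fin n → ℝ) : Prop :=
  (∀ i j k l, c i j k l = c k l i j) ∧
  (∀ i j k l, c i j k l = -c j i k l) ∧
  (∀ i j k l, c i j k l = -c i j l k) ∧
  (∀ i j k l, c i j k l + c j k i l + c k i j l = 0)

/-- The Clifford contraction of a curvature-type tensor, in any algebra whose elements `e i`
satisfy the Clifford relations `e i * e j + e j * e i = -2 δ i j`. -/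
theorem IsCurvatureTensor.sum_smul_clifford {n : ℕ} {A : Type*} [Ring A] [Algebra ℝ A]
    {d : Fin n → Fin n → Fin n → Fin n → ℝ} (hd : IsCurvatureTensor d) (e : Fin n → A)
    (he : ∀ i j, e i * e j + e j * e i = (if i = j then (-2 : ℝ) else 0) • (1 : A)) :
    ∑ i, ∑ j, ∑ k, ∑ l, d i j k l • (e i * e j * e k * e l) =
      (-2 * ∑ i, ∑ j, d i j i j) • (1 : A) := by
  obtain ⟨pair, anti, -, bianchi⟩ := hd
  have diag : ∀ i k l, d i i k l = 0 := fun i k l => by linarith [anti i i k l]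
  set S := ∑ i, ∑ j, ∑ k, ∑ l, d i j k l • (e i * e j * e k * e l) with hS
  set R := ∑ i, ∑ j, ∑ l, d i j i l • (e j * e l) with hR
  have swap : ∀ i j, e j * e i = (if i = j then (-2 : ℝ) else 0) • (1 : A) - e i * e j :=
    fun i j => eq_sub_of_add_eq' (he i j)
  have left : ∀ i j k l, e k * e i * e j * e l = e i * e j * e k * e l
      + ((if i = k then (-2 : ℝ) else 0) • (e j * e l)
      - (if j = k then (-2 : ℝ) else 0) • (e i * e l)) := fun i j k l => by
    rw [swap i k, sub_mul, mul_assoc (e i) (e k), swap j k]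
    simp only [sub_mul, mul_sub, smul_mul_assoc, mul_smul_comm, one_mul, mul_one, mul_assoc]
    abel
  have right : ∀ i j k l, d i j k l • (e j * e k * e i * e l) =
      d i j k l • (e i * e j * e k * e l)
        + d i j k l • ((if i = k then (-2 : ℝ) else 0) • (e j * e l)) := fun i j k l => by
    by_cases h : i = j
    · simp [h, diag]
    rw [← smul_add, mul_assoc (e j), swap i k, mul_sub, ← mul_assoc (e j), swap i j, if_neg h,
      zero_smul, zero_sub]
    congr 1
    simp only [sub_mul, neg_mul, smul_mul_assoc, mul_smul_comm, mul_one, mul_assoc]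
    abel
  have contract₁₃ : ∑ i, ∑ j, ∑ k, ∑ l,
      d i j k l • ((if i = k then (-2 : ℝ) else 0) • (e j * e l)) = (-2 : ℝ) • R := by
    simp only [hR, Finset.smul_sum]
    refine Finset.sum_congr rfl fun i _ => Finset.sum_congr rfl fun j _ => ?_
    rw [Finset.sum_eq_single i (fun k _ h => by simp [h.symm]) (by simp)]
    simp [smul_smul, mul_comm]
  have contract₂₃ : ∑ i, ∑ j, ∑ k, ∑ l,
      d i j k l • ((if j = k then (-2 : ℝ) else 0) • (e i * e l)) = (2 : ℝ) • R := by
    rw [Finset.sum_comm]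
    simp only [hR, Finset.smul_sum]
    refine Finset.sum_congr rfl fun j _ => Finset.sum_congr rfl fun i _ => ?_
    rw [Finset.sum_eq_single j (fun k _ h => by simp [h.symm]) (by simp)]
    refine Finset.sum_congr rfl fun l _ => ?_
    rw [if_pos rfl, anti i j j l, smul_smul, smul_smul]
    congr 1
    ring
  have cycle : ∀ f : Fin n → Fin n → Fin n → A,
      ∑ i, ∑ j, ∑ k, f i j k = ∑ i, ∑ j, ∑ k, f k i j := fun f => by
    rw [Finset.sum_comm]
    simp_rw [Finset.sum_comm (s := Finset.univ) (t := Finset.univ) (f := fun i k => f i _ k)]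
  have hleft : ∑ i, ∑ j, ∑ k, ∑ l, d j k i l • (e i * e j * e k * e l) =
      S + ((-2 : ℝ) • R - (2 : ℝ) • R) := by
    rw [cycle, ← contract₁₃, ← contract₂₃, hS]
    simp only [← Finset.sum_add_distrib, ← Finset.sum_sub_distrib]
    refine Finset.sum_congr rfl fun i _ => Finset.sum_congr rfl fun j _ =>
      Finset.sum_congr rfl fun k _ => Finset.sum_congr rfl fun l _ => ?_
    rw [left, smul_add, smul_sub]
  have hright : ∑ i, ∑ j, ∑ k, ∑ l, d k i j l • (e i * e j * e k * e l) =
      S + (-2 : ℝ) • R := by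
    rw [← cycle fun i j k => ∑ l, d i j k l • (e j * e k * e i * e l), ← contract₁₃, hS]
    simp only [← Finset.sum_add_distrib]
    refine Finset.sum_congr rfl fun i _ => Finset.sum_congr rfl fun j _ =>
      Finset.sum_congr rfl fun k _ => Finset.sum_congr rfl fun l _ => ?_
    exact right i j k l
  have hcyc : S + (S + ((-2 : ℝ) • R - (2 : ℝ) • R)) + (S + (-2 : ℝ) • R) = 0 := by
    rw [← hleft, ← hright, hS]
    simp only [← Finset.sum_add_distrib, ← add_smul, bianchi, zero_smul, Finset.sum_const_zero]
  have hSR : S = (2 : ℝ) • R := by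
    have h : (3 : ℝ) • (S - (2 : ℝ) • R) = 0 := by
      rw [← hcyc]
      module
    exact sub_eq_zero.mp ((smul_eq_zero.mp h).resolve_left (by norm_num))
  have hR' : R = ∑ i, ∑ j, ∑ l, d i j i l • (e l * e j) := by
    refine Finset.sum_congr rfl fun i _ => ?_
    rw [Finset.sum_comm]
    refine Finset.sum_congr rfl fun j _ => Finset.sum_congr rfl fun l _ => ?_
    rw [pair i l i j]
  have hRR : R + R = (-2 * ∑ i, ∑ j, d i j i j) • (1 : A) := by
    nth_rw 2 [hR']
    simp only [hR, ← Finset.sum_add_distrib, ← smul_add, he, Finset.mul_sum, Finset.sum_smul]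
    refine Finset.sum_congr rfl fun i _ => Finset.sum_congr rfl fun j _ => ?_
    rw [Finset.sum_eq_single j (fun k _ h => by simp [h.symm]) (by simp)]
    simp [smul_smul, mul_comm]
  rw [hSR, two_smul, hRR]

/-- Curvature-type tensors are preserved by weighting every index. -/
theorem IsCurvatureTensor.weighted {n : ℕ} {c : Fin n → Fin n → Fin n → Fin n → ℝ}
    (hc : IsCurvatureTensor c) (μ : Fin n → ℝ) :
    IsCurvatureTensor fun i j k l => μ i * μ j * μ k * μ l * c i j k l := by
  obtain ⟨pair, anti, anti', bianchi⟩ := hc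
  refine ⟨fun i j k l => ?_, fun i j k l => ?_, fun i j k l => ?_, fun i j k l => ?_⟩
  · dsimp only; rw [pair i j k l]; ring
  · dsimp only; rw [anti i j k l]; ring
  · dsimp only; rw [anti' i j k l]; ring
  · linear_combination (μ i * μ j * μ k * μ l) * bianchi i j k l

theorem CliffordAlgebra.ι_basisFun_mul_add_swap {n : ℕ}
    (Q : QuadraticForm ℝ (EuclideanSpace ℝ (Fin n))) (hQ : ∀ x, Q x = -‖x‖ ^ 2) (i j : Fin n) :
    CliffordAlgebra.ι Q (EuclideanSpace.basisFun (Fin n) ℝ i) *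
        CliffordAlgebra.ι Q (EuclideanSpace.basisFun (Fin n) ℝ j) +
      CliffordAlgebra.ι Q (EuclideanSpace.basisFun (Fin n) ℝ j) *
        CliffordAlgebra.ι Q (EuclideanSpace.basisFun (Fin n) ℝ i) =
      (if i = j then (-2 : ℝ) else 0) • (1 : CliffordAlgebra Q) := by
  rw [CliffordAlgebra.ι_mul_ι_add_swap, Algebra.algebraMap_eq_smul_one, QuadraticMap.polar,
    hQ, hQ, hQ, norm_add_sq_real,
    orthonormal_iff_ite.mp (EuclideanSpace.basisFun (Fin n) ℝ).orthonormal i j]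
  congr 1
  split_ifs <;> ring

/-- In the Clifford algebra of `Q x = −‖x‖²` on `EuclideanSpace ℝ (Fin n)`, for a
curvature-type tensor `c` and arbitrary weights `μ`, the weighted quadruple Clifford sum
`∑ μ_i μ_j μ_k μ_l (c i j k l) e_i e_j e_k e_l` is the scalar
`−2 ∑ μ_i² μ_j² (c i j i j)`. -/
theorem stmt_3 {n : ℕ} (Q : QuadraticForm ℝ (EuclideanSpace ℝ (Fin n)))
    (hQ : ∀ x, Q x = -‖x‖ ^ 2)
    (c : Fin n → Fin n → Fin n → Fin n → ℝ) (hc : IsCurvatureTensor c)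
    (μ : Fin n → ℝ) :
    (∑ i, ∑ j, ∑ k, ∑ l, (μ i * μ j * μ k * μ l * c i j k l) •
      (CliffordAlgebra.ι Q (EuclideanSpace.basisFun (Fin n) ℝ i) *
       CliffordAlgebra.ι Q (EuclideanSpace.basisFun (Fin n) ℝ j) *
       CliffordAlgebra.ι Q (EuclideanSpace.basisFun (Fin n) ℝ k) *
       CliffordAlgebra.ι Q (EuclideanSpace.basisFun (Fin n) ℝ l))) =
    algebraMap ℝ (CliffordAlgebra Q) (-2 * ∑ i, ∑ j, μ i ^ 2 * μ j ^ 2 * c i j i j) := by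
  have h := (hc.weighted μ).sum_smul_clifford _ (CliffordAlgebra.ι_basisFun_mul_add_swap Q hQ)
  rw [h, Algebra.algebraMap_eq_smul_one]
  refine congrArg (fun r : ℝ => (-2 * r) • (1 : CliffordAlgebra Q)) ?_
  refine Finset.sum_congr rfl fun i _ => Finset.sum_congr rfl fun j _ => ?_
  ring
end
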